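/- Let r ≥ 3 and k ≥ 1 be integers, let C ≥ 4er^2·binom(k+r-2, r-1)·((2k+2r-3)e)^{1/binom(k+r-2, r-1)}, and let p = C·n^{-1/binom(k+r-2, r-1)}. Let X be the random variable counting the number of σ ∈ Q_n with H_σ ⊆ H^{(r)}(n,p). Then there exists a constant D > 0 depending only on r and k such that for all sufficiently large n, E[X²] ≤ D·E[X]². -/

import Mathlib

open scoped Classical
open Finset

noncomputable section

/-- The window of `k+r-1` cyclically consecutive vertices starting at position `i`,
under the cyclic ordering `σ`. -/
def cycWindow (k r n : ℕ) (σ : ZMod n → Fin n) (i : ZMod n) : Finset (Fin n) :=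
  (Finset.range (k + r - 1)).image fun j => σ (i + (j : ZMod n))

/-- The edge set of the `k`th power of a tight Hamilton cycle on `[n]` associated with
the cyclic ordering `σ`: all `r`-sets contained in some window of `k+r-1`
cyclically consecutive vertices. -/
def hamPowEdges (r k n : ℕ) (σ : ZMod n → Fin n) : Finset (Finset (Fin n)) :=
  Finset.univ.filter fun e => e.card = r ∧ ∃ i : ZMod n, e ⊆ cycWindow k r n σ i

/-- All `r`-element subsets of `Fin n`. -/
def rSets (n r : ℕ) : Finset (Finset (Fin n)) := Finset.univ.filter fun e => e.card = r

/-- The probability weight of a given `r`-graph `H` in the binomial random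
`r`-graph `H^{(r)}(n,p)`. -/
def prW (n r : ℕ) (p : ℝ) (H : Finset (Finset (Fin n))) : ℝ :=
  p ^ H.card * (1 - p) ^ ((rSets n r).card - H.card)

/-- The probability that `H^{(r)}(n,p)` satisfies the property `A`. -/
def probOf (n r : ℕ) (p : ℝ) (A : Finset (Finset (Fin n)) → Prop) : ℝ :=
  ∑ H ∈ (rSets n r).powerset, if A H then prW n r p H else 0

/-- The expectation of `f` with respect to the random `r`-graph `H^{(r)}(n,p)`. -/
def expct (n r : ℕ) (p : ℝ) (f : Finset (Finset (Fin n)) → ℝ) : ℝ :=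
  ∑ H ∈ (rSets n r).powerset, prW n r p H * f H

/-- `H` contains (a spanning copy of) the `k`th power of a tight Hamilton cycle. -/
def containsHamPow (r k n : ℕ) (H : Finset (Finset (Fin n))) : Prop :=
  ∃ σ : ZMod n → Fin n, Function.Bijective σ ∧ hamPowEdges r k n σ ⊆ H

/-- Degree of a vertex in a hypergraph given by its edge set. -/
def degOf (n : ℕ) (H : Finset (Finset (Fin n))) (v : Fin n) : ℕ :=
  (H.filter fun e => v ∈ e).card

/-- The auxiliary graph on the edges of a hypergraph `P`, two edges being adjacent
iff they are distinct and share a vertex. -/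
def edgeGraph {n : ℕ} (P : Finset (Finset (Fin n))) : SimpleGraph {e // e ∈ P} :=
  SimpleGraph.fromRel fun e f => (e.1 ∩ f.1).Nonempty

/-- The number of connected components of the hypergraph with edge set `P`. -/
def numComp {n : ℕ} (P : Finset (Finset (Fin n))) : ℕ :=
  Nat.card (edgeGraph P).ConnectedComponent

/-- The set of vertices covered by the edges of `P`. -/
def vertsOf {n : ℕ} (P : Finset (Finset (Fin n))) : Finset (Fin n) := P.biUnion id

/-- `σ` is the canonical representative of a cyclic ordering of `[n]`
(a permutation considered up to rotation and reflection). -/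
def IsCycRep (n : ℕ) (σ : ZMod n → Fin n) : Prop :=
  Function.Bijective σ ∧ (σ 0).val = 0 ∧ (σ 1).val < (σ (-1)).val

/-- `|Q_n|`, the number of cyclic orderings of `[n]`. -/
def QCard (n : ℕ) : ℕ := Nat.card {σ : ZMod n → Fin n // IsCycRep n σ}

/-- `N_σ(b)`: the number of cyclic orderings `τ ∈ Q_n` such that `H_σ` and `H_τ`
share exactly `b` edges. -/
def NQ (r k n : ℕ) (σ : ZMod n → Fin n) (b : ℕ) : ℕ :=
  Nat.card {τ : ZMod n → Fin n //
    IsCycRep n τ ∧ (hamPowEdges r k n σ ∩ hamPowEdges r k n τ).card = b}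

/-- `N_σ(b,s)`: the number of cyclic orderings `τ ∈ Q_n` such that `H_σ ∩ H_τ`
has exactly `b` edges and exactly `s` connected components. -/
def NQs (r k n : ℕ) (σ : ZMod n → Fin n) (b s : ℕ) : ℕ :=
  Nat.card {τ : ZMod n → Fin n //
    IsCycRep n τ ∧ (hamPowEdges r k n σ ∩ hamPowEdges r k n τ).card = b ∧
      numComp (hamPowEdges r k n σ ∩ hamPowEdges r k n τ) = s}

/-- The random variable `X`: the number of cyclic orderings `σ ∈ Q_n` with `H_σ ⊆ H`. -/
def XH (r k n : ℕ) (H : Finset (Finset (Fin n))) : ℝ :=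
  Nat.card {σ : ZMod n → Fin n // IsCycRep n σ ∧ hamPowEdges r k n σ ⊆ H}

/-- The auxiliary graph on a finite set `P` of edges of a simple graph, two edges
being adjacent iff they are distinct and share a vertex. -/
def edgeGraphS {V : Type*} (P : Finset (Sym2 V)) : SimpleGraph {e // e ∈ P} :=
  SimpleGraph.fromRel fun e f => ∃ x, x ∈ e.1 ∧ x ∈ f.1

/-- Bijections that differ by a translation on every fibre of `ρ` are determined by the order in
which the fibres first occur. -/
lemma card_le_factorial_of_fibre_translate {α β : Type*} [Fintype α] [Fintype β] {n : ℕ}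
    (ρ : α → β) (hρ : Function.Surjective ρ) (T : Finset (α ≃ Fin n))
    (hT : ∀ τ ∈ T, ∀ τ' ∈ T, ∀ x y, ρ x = ρ y →
      ((τ x : ℕ) : ℤ) - ((τ' x : ℕ) : ℤ) = ((τ y : ℕ) : ℤ) - ((τ' y : ℕ) : ℤ)) :
    T.card ≤ (Fintype.card β).factorial := by
  have hmin : ∀ (τ : α ≃ Fin n) (b : β), ∃ x, ρ x = b ∧ ∀ y, ρ y = b → (τ x : ℕ) ≤ τ y := by
    intro τ b
    obtain ⟨x0, hx0⟩ := hρ b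
    obtain ⟨x, hx, hm⟩ := Finset.exists_min_image (univ.filter fun x => ρ x = b)
      (fun x => (τ x : ℕ)) ⟨x0, by simp [hx0]⟩
    refine ⟨x, by simpa using hx, fun y hy => hm y (by simp [hy])⟩
  choose a ha hamin using hmin
  let m : (α ≃ Fin n) → β → ℕ := fun τ b => (τ (a τ b) : ℕ)
  have hminj : ∀ τ, Function.Injective (m τ) := by
    intro τ b b' h
    have h1 : a τ b = a τ b' := τ.injective (Fin.ext h)
    rw [← ha τ b, h1, ha]
  let rk : (α ≃ Fin n) → β → ℕ := fun τ b => (univ.filter fun b' => m τ b' < m τ b).card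
  have hrklt : ∀ τ b, rk τ b < Fintype.card β := by
    intro τ b
    refine Finset.card_lt_univ_of_notMem (x := b) (by simp)
  have hrkmono : ∀ τ b b', m τ b < m τ b' → rk τ b < rk τ b' := by
    intro τ b b' h
    refine Finset.card_lt_card ?_
    rw [Finset.ssubset_iff_of_subset]
    · exact ⟨b, by simpa using h, by simp⟩
    · intro c hc
      simp only [mem_filter, mem_univ, true_and] at hc ⊢
      omega
  have hrkiff : ∀ τ b b', rk τ b < rk τ b' ↔ m τ b < m τ b' := by
    intro τ b b'
    refine ⟨fun h => ?_, hrkmono τ b b'⟩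
    by_contra hcon
    rcases (not_lt.mp hcon).lt_or_eq with h' | h'
    · have := hrkmono τ b' b h'
      omega
    · rw [hminj τ h'] at h
      omega
  let E : (α ≃ Fin n) → (β ↪ Fin (Fintype.card β)) := fun τ =>
    ⟨fun b => ⟨rk τ b, hrklt τ b⟩, by
      intro b b' h
      have h : rk τ b = rk τ b' := by simpa using h
      by_contra hne
      rcases lt_or_gt_of_ne (fun h => hne (hminj τ h)) with h1 | h1
      · have := hrkmono τ _ _ h1
        omega
      · have := hrkmono τ _ _ h1
        omega⟩
  have hE : Set.InjOn E T := by
    intro τ hτ τ' hτ' hEE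
    have hrk : ∀ b, rk τ b = rk τ' b := by
      intro b
      have := congrArg (fun e => ((e b : Fin _) : ℕ)) hEE
      exact this
    have hm : ∀ b b', m τ' b < m τ' b' → m τ b < m τ b' := by
      intro b b' h
      rw [← hrkiff] at h ⊢
      rwa [hrk, hrk]
    have key : ∀ N b, m τ b = N → ∀ x, ρ x = b → τ x = τ' x := by
      intro N
      induction N using Nat.strong_induction_on with
      | _ N ih =>
        intro b hb x hx
        by_contra hne
        have hne' : (τ x : ℕ) ≠ τ' x := fun h => hne (Fin.ext h)
        have h1 := hT τ hτ τ' hτ' (a τ b) x (by rw [ha, hx])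
        have h2 := hT τ hτ τ' hτ' (a τ' b) x (by rw [ha, hx])
        have h3 := hamin τ b (a τ' b) (ha _ _)
        have h4 := hamin τ' b (a τ b) (ha _ _)
        rcases lt_or_gt_of_ne hne' with hlt | hlt
        · set y := τ'.symm (τ (a τ b)) with hy
          have hy' : τ' y = τ (a τ b) := by simp [hy]
          have h5 := hamin τ' (ρ y) y rfl
          have h6 : m τ (ρ y) < m τ b := by
            apply hm
            simp only [m]
            rw [hy'] at h5
            omega
          have h7 := ih _ (hb ▸ h6) (ρ y) rfl y rfl
          have h8 : y = a τ b := τ.injective (h7.trans hy')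
          rw [h8, ha] at h6
          omega
        · set y := τ.symm (τ' (a τ' b)) with hy
          have hy' : τ y = τ' (a τ' b) := by simp [hy]
          have h5 := hamin τ (ρ y) y rfl
          have h6 : m τ (ρ y) < m τ b := by
            simp only [m]
            rw [hy'] at h5
            omega
          have h7 := ih _ (hb ▸ h6) (ρ y) rfl y rfl
          have h8 : y = a τ' b := τ'.injective (h7.symm.trans hy')
          rw [h8, ha] at h6
          omega
    ext x
    rw [key _ (ρ x) rfl x rfl]
  calc T.card = (T.image E).card := (Finset.card_image_of_injOn hE).symm
    _ ≤ Fintype.card (β ↪ Fin (Fintype.card β)) := Finset.card_le_univ _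
    _ = _ := by simp [Fintype.card_embedding_eq, Nat.descFactorial_self]

/-- Bijections with prescribed increments along a parent function on `S` number at most
`(n - |S|)!`. -/
lemma card_le_factorial_of_increments {n : ℕ} (S : Finset (Fin n)) (par : Fin n → Fin n)
    (hpar : ∀ i ∈ S, par i < i) (T : Finset (Fin n ≃ Fin n))
    (hT : ∀ τ ∈ T, ∀ τ' ∈ T, ∀ i ∈ S,
      ((τ i : ℕ) : ℤ) - ((τ (par i) : ℕ) : ℤ) = ((τ' i : ℕ) : ℤ) - ((τ' (par i) : ℕ) : ℤ)) :
    T.card ≤ (n - S.card).factorial := by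
  have hroot : ∀ N : ℕ, ∀ i : Fin n, (i : ℕ) = N → ∃ ρ ∈ Sᶜ, ∀ τ ∈ T, ∀ τ' ∈ T,
      ((τ i : ℕ) : ℤ) - ((τ' i : ℕ) : ℤ) = ((τ ρ : ℕ) : ℤ) - ((τ' ρ : ℕ) : ℤ) := by
    intro N
    induction N using Nat.strong_induction_on with
    | _ N ih =>
      intro i hi
      by_cases hS : i ∈ S
      · obtain ⟨ρ, hρ, h⟩ := ih _ (hi ▸ hpar i hS) (par i) rfl
        refine ⟨ρ, hρ, fun τ hτ τ' hτ' => ?_⟩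
        have := h τ hτ τ' hτ'
        have := hT τ hτ τ' hτ' i hS
        omega
      · exact ⟨i, by simpa using hS, fun _ _ _ _ => rfl⟩
  choose ρ hρS hρ using fun i => hroot _ i rfl
  have h := card_le_factorial_of_fibre_translate (β := Set.range ρ) (Set.rangeFactorization ρ)
    Set.rangeFactorization_surjective T (by
      intro τ hτ τ' hτ' x y hxy
      have hxy : ρ x = ρ y := congrArg Subtype.val hxy
      rw [hρ x τ hτ τ' hτ', hρ y τ hτ τ' hτ', hxy])
  refine h.trans (Nat.factorial_le ?_)
  rw [← Set.toFinset_card]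
  calc (Set.range ρ).toFinset.card ≤ (Sᶜ).card := by
        refine Finset.card_le_card fun x hx => ?_
        obtain ⟨i, rfl⟩ := by simpa using hx
        exact hρS i
    _ = n - S.card := by simp [Finset.card_compl]

lemma pow_mul_factorial_sub_le (n a : ℕ) (ha : a ≤ n) :
    (n : ℝ) ^ a * (n - a).factorial ≤ Real.exp 1 ^ a * n.factorial := by
  induction n generalizing a with
  | zero => simp_all
  | succ n ih =>
    cases a with
    | zero => simp
    | succ a =>
      have h := ih a (by omega)
      rw [Nat.add_sub_add_right]
      have h1 : ((n : ℝ) + 1) ^ a ≤ Real.exp 1 * (n : ℝ) ^ a := by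
        rcases Nat.eq_zero_or_pos n with rfl | hn
        · obtain rfl : a = 0 := by omega
          simp
        have hn' : (0 : ℝ) < n := by exact_mod_cast hn
        have h2 : 1 + 1 / (n : ℝ) ≤ Real.exp (1 / n) := by
          linarith [Real.add_one_le_exp (1 / (n : ℝ))]
        have h3 : ((n : ℝ) + 1) = n * (1 + 1 / n) := by field_simp
        rw [h3, mul_pow, mul_comm]
        gcongr
        calc (1 + 1 / (n : ℝ)) ^ a ≤ (Real.exp (1 / n)) ^ a := by gcongr
          _ = Real.exp (a / n) := by rw [← Real.exp_nat_mul]; ring_nf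
          _ ≤ Real.exp 1 := by
            apply Real.exp_le_exp.mpr
            rw [div_le_one hn']
            exact_mod_cast (by omega : a ≤ n)
      push_cast [Nat.factorial_succ]
      calc ((n : ℝ) + 1) ^ (a + 1) * (n - a).factorial
          = ((n : ℝ) + 1) * (((n : ℝ) + 1) ^ a * (n - a).factorial) := by ring
        _ ≤ ((n : ℝ) + 1) * ((Real.exp 1 * (n : ℝ) ^ a) * (n - a).factorial) := by gcongr
        _ = ((n : ℝ) + 1) * Real.exp 1 * ((n : ℝ) ^ a * (n - a).factorial) := by ring
        _ ≤ ((n : ℝ) + 1) * Real.exp 1 * (Real.exp 1 ^ a * n.factorial) := by gcongr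
        _ = _ := by ring

/-- The elements of `S` having another element of `S` at most `w` below them. -/
def followers (w : ℕ) (S : Finset ℕ) : Finset ℕ := S.filter fun i => ∃ j ∈ S, j < i ∧ i ≤ j + w

lemma followers_subset (w : ℕ) (S : Finset ℕ) : followers w S ⊆ S := filter_subset _ _

/-- Elements of `S` not being followers carry weight `y`, followers carry weight `x`. -/
def runWeight (w : ℕ) (x y : ℝ) (S : Finset ℕ) : ℝ :=
  x ^ (followers w S).card * y ^ (S.card - (followers w S).card)

lemma runWeight_nonneg (w : ℕ) {x y : ℝ} (hx : 0 ≤ x) (hy : 0 ≤ y) (S : Finset ℕ) :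
    0 ≤ runWeight w x y S := by unfold runWeight; positivity

lemma runWeight_insert (w : ℕ) (x y : ℝ) {m : ℕ} {S : Finset ℕ} (hS : S ⊆ range m) :
    runWeight w x y (insert m S) =
      (if ∃ j ∈ S, m ≤ j + w then x else y) * runWeight w x y S := by
  have hlt : ∀ j ∈ S, j < m := fun j hj => by simpa using hS hj
  have hm : m ∉ S := fun h => lt_irrefl _ (hlt m h)
  have hmF : m ∉ followers w S := fun h => hm (followers_subset w S h)
  have hle := Finset.card_le_card (followers_subset w S)
  unfold runWeight
  rw [Finset.card_insert_of_notMem hm]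
  by_cases h : ∃ j ∈ S, m ≤ j + w
  · have : followers w (insert m S) = insert m (followers w S) := by
      ext i
      simp only [followers, mem_filter, mem_insert]
      constructor
      · rintro ⟨rfl | hi, j, rfl | hj, h1, h2⟩
        · omega
        · exact Or.inl rfl
        · have := hlt i hi
          omega
        · exact Or.inr ⟨hi, j, hj, h1, h2⟩
      · rintro (rfl | ⟨hi, j, hj, h1, h2⟩)
        · obtain ⟨j, hj, h⟩ := h
          exact ⟨Or.inl rfl, j, Or.inr hj, hlt j hj, h⟩
        · exact ⟨Or.inr hi, j, Or.inr hj, h1, h2⟩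
    rw [this, Finset.card_insert_of_notMem hmF, if_pos h, Nat.add_sub_add_right, pow_succ]
    ring
  · have : followers w (insert m S) = followers w S := by
      ext i
      simp only [followers, mem_filter, mem_insert]
      constructor
      · rintro ⟨rfl | hi, j, rfl | hj, h1, h2⟩
        · omega
        · exact absurd ⟨j, hj, h2⟩ h
        · have := hlt i hi
          omega
        · exact ⟨hi, j, hj, h1, h2⟩
      · rintro ⟨hi, j, hj, h1, h2⟩
        exact ⟨Or.inr hi, j, Or.inr hj, h1, h2⟩
    rw [this, if_neg h, Nat.succ_sub hle, pow_succ]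
    ring

lemma sum_runWeight_le (w : ℕ) (x y : ℝ) (hx : 0 ≤ x) (hy : 0 ≤ y) (hwx : w * x ≤ 1 / 2) (n : ℕ) :
    ∑ S ∈ (range n).powerset, runWeight w x y S ≤ (1 + 2 * y) ^ n := by
  let V : ℕ → ℝ := fun m => ∑ S ∈ (range m).powerset, runWeight w x y S
  let U : ℕ → ℝ := fun m => ∑ S ∈ (range m).powerset, runWeight w x y (insert m S)
  have hV : ∀ m, V (m + 1) = V m + U m := fun m => by
    simp only [V, U]
    rw [Finset.range_add_one, Finset.sum_powerset_insert (by simp)]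
  have hU0 : ∀ m, 0 ≤ U m := fun m => Finset.sum_nonneg fun S _ => runWeight_nonneg w hx hy _
  have hU : ∀ m, U m ≤ x * ∑ j ∈ Ico (m - w) m, U j + y * V m := by
    intro m
    have h1 : ∀ S ∈ (range m).powerset, runWeight w x y (insert m S) ≤
        x * (∑ j ∈ Ico (m - w) m, if j ∈ S ∧ S ⊆ range (j + 1) then runWeight w x y S else 0)
          + y * runWeight w x y S := by
      intro S hS
      rw [mem_powerset] at hS
      have h0 := runWeight_nonneg w hx hy S
      have hs : ∀ j ∈ Ico (m - w) m,
          0 ≤ if j ∈ S ∧ S ⊆ range (j + 1) then runWeight w x y S else 0 := by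
        intro j _
        split_ifs <;> simp [h0]
      rw [runWeight_insert w x y hS]
      split_ifs with h
      · obtain ⟨j, hj, hjm⟩ := h
        have hne : S.Nonempty := ⟨j, hj⟩
        have hM := Finset.max'_mem S hne
        have hMj := Finset.le_max' S j hj
        have hMm : S.max' hne < m := by simpa using hS hM
        have h2 := Finset.single_le_sum hs (a := S.max' hne) (by rw [mem_Ico]; omega)
        rw [if_pos ⟨hM, fun i hi => by
          have := Finset.le_max' S i hi
          simp only [Finset.mem_range]
          omega⟩] at h2
        nlinarith [mul_le_mul_of_nonneg_left h2 hx, mul_nonneg hy h0]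
      · nlinarith [mul_nonneg hx (Finset.sum_nonneg hs)]
    calc U m ≤ ∑ S ∈ (range m).powerset, (x * (∑ j ∈ Ico (m - w) m,
          if j ∈ S ∧ S ⊆ range (j + 1) then runWeight w x y S else 0) + y * runWeight w x y S) :=
          Finset.sum_le_sum h1
      _ = x * ∑ j ∈ Ico (m - w) m, (∑ S ∈ (range m).powerset,
          if j ∈ S ∧ S ⊆ range (j + 1) then runWeight w x y S else 0) + y * V m := by
          rw [Finset.sum_add_distrib, ← Finset.mul_sum, ← Finset.mul_sum, Finset.sum_comm]
      _ = _ := by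
          congr 2
          refine Finset.sum_congr rfl fun j hj => ?_
          rw [mem_Ico] at hj
          rw [← Finset.sum_filter]
          symm
          refine Finset.sum_bij' (fun S _ => insert j S) (fun S _ => S.erase j) ?_ ?_ ?_ ?_ ?_
          · intro S hS
            simp only [mem_powerset, mem_filter] at hS ⊢
            refine ⟨?_, mem_insert_self _ _, ?_⟩
            · intro i hi
              rcases mem_insert.mp hi with rfl | hi
              · simpa using hj.2
              · have := hS hi
                simp only [Finset.mem_range] at this ⊢
                omega
            · rw [Finset.range_add_one]
              exact Finset.insert_subset_insert _ hS
          · intro S hS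
            simp only [mem_powerset, mem_filter] at hS ⊢
            intro i hi
            have := hS.2.2 (mem_of_mem_erase hi)
            have := ne_of_mem_erase hi
            simp only [Finset.mem_range] at *
            omega
          · intro S hS
            refine Finset.erase_insert fun h => ?_
            simpa using (mem_powerset.mp hS) h
          · intro S hS
            exact Finset.insert_erase (mem_filter.mp hS).2.1
          · intro S _
            rfl
  have hmain : ∀ m, (∀ j < m, U j ≤ 2 * y * (1 + 2 * y) ^ j) ∧ V m ≤ (1 + 2 * y) ^ m := by
    intro m
    induction m with
    | zero => simp [V, runWeight, followers]
    | succ m ih =>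
      have hUm : U m ≤ 2 * y * (1 + 2 * y) ^ m := by
        have h1 : ∑ j ∈ Ico (m - w) m, U j ≤ w * (2 * y * (1 + 2 * y) ^ m) := by
          have h2 : ∀ j ∈ Ico (m - w) m, U j ≤ 2 * y * (1 + 2 * y) ^ m := by
            intro j hj
            rw [mem_Ico] at hj
            refine (ih.1 j hj.2).trans ?_
            gcongr
            · linarith
            · exact hj.2.le
          refine (Finset.sum_le_card_nsmul _ _ _ h2).trans ?_
          rw [nsmul_eq_mul]
          gcongr
          simp only [Nat.card_Ico]
          omega
        have h0 : 0 ≤ 2 * y * (1 + 2 * y) ^ m := by positivity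
        calc U m ≤ x * ∑ j ∈ Ico (m - w) m, U j + y * V m := hU m
          _ ≤ x * (w * (2 * y * (1 + 2 * y) ^ m)) + y * (1 + 2 * y) ^ m := by
            gcongr
            exact ih.2
          _ = (w * x) * (2 * y * (1 + 2 * y) ^ m) + y * (1 + 2 * y) ^ m := by ring
          _ ≤ (1 / 2) * (2 * y * (1 + 2 * y) ^ m) + y * (1 + 2 * y) ^ m := by gcongr
          _ = _ := by ring
      refine ⟨fun j hj => ?_, ?_⟩
      · rcases Nat.lt_succ_iff_lt_or_eq.mp hj with h | rfl
        · exact ih.1 j h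
        · exact hUm
      · rw [hV, pow_succ]
        linarith [ih.2]
  exact (hmain n).2

/-- Nonzero differences of residues in `[0, n)` at cyclic distance at most `w`. -/
def cyclicDiffs (n w : ℕ) : Finset ℤ :=
  (Ioo (-(n : ℤ)) n).filter fun z => z ≠ 0 ∧ (|z| ≤ w ∨ (n : ℤ) - w ≤ |z|)

lemma card_cyclicDiffs_le (n w : ℕ) : (cyclicDiffs n w).card ≤ 4 * w := by
  have hsub : cyclicDiffs n w ⊆ ((Icc 1 (w : ℤ) ∪ Icc (-(w : ℤ)) (-1)) ∪
      (Icc ((n : ℤ) - w) (n - 1) ∪ Icc (1 - (n : ℤ)) (w - n))) := by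
    intro z hz
    simp only [cyclicDiffs, mem_filter, mem_Ioo, mem_union, mem_Icc] at hz ⊢
    rcases abs_cases z with ⟨h, _⟩ | ⟨h, _⟩ <;> rw [h] at hz <;> omega
  refine (card_le_card hsub).trans ?_
  refine (card_union_le _ _).trans ?_
  have h1 := card_union_le (Icc 1 (w : ℤ)) (Icc (-(w : ℤ)) (-1))
  have h2 := card_union_le (Icc ((n : ℤ) - w) (n - 1)) (Icc (1 - (n : ℤ)) (w - n))
  simp only [Int.card_Icc] at h1 h2
  omega

/-- Positions `i` mapped by `θ` cyclically close to the image of one of the `w` preceding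
positions. -/
def closeSet {n : ℕ} (w : ℕ) (θ : Fin n ≃ Fin n) : Finset (Fin n) :=
  univ.filter fun i => ∃ j : Fin n, (j : ℕ) < i ∧ (i : ℕ) ≤ j + w ∧
    ((θ i : ℕ) : ℤ) - ((θ j : ℕ) : ℤ) ∈ cyclicDiffs n w

lemma card_closeSet_eq_le {n : ℕ} (w : ℕ) (S : Finset (Fin n)) :
    (univ.filter fun θ : Fin n ≃ Fin n => closeSet w θ = S).card ≤
      (4 * w ^ 2) ^ S.card * (n - S.card).factorial := by
  have hex : ∀ (θ : Fin n ≃ Fin n) (i : Fin n), ∃ j : Fin n, i ∈ closeSet w θ →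
      ((j : ℕ) < i ∧ (i : ℕ) ≤ j + w ∧
        ((θ i : ℕ) : ℤ) - ((θ j : ℕ) : ℤ) ∈ cyclicDiffs n w) := by
    intro θ i
    by_cases h : i ∈ closeSet w θ
    · obtain ⟨j, hj⟩ := (mem_filter.mp h).2
      exact ⟨j, fun _ => hj⟩
    · exact ⟨i, fun h' => absurd h' h⟩
  choose J hJ using hex
  let code : (Fin n ≃ Fin n) → ((i : Fin n) → i ∈ S → Fin n × ℤ) := fun θ i _ =>
    (J θ i, ((θ i : ℕ) : ℤ) - ((θ (J θ i) : ℕ) : ℤ))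
  let before : Fin n → Finset (Fin n) := fun i =>
    univ.filter fun j => (j : ℕ) < i ∧ (i : ℕ) ≤ j + w
  have hbefore : ∀ i, (before i).card ≤ w := by
    intro i
    calc (before i).card = ((before i).map Fin.valEmbedding).card := (card_map _).symm
      _ ≤ (Ico ((i : ℕ) - w) i).card := by
        refine card_le_card fun j hj => ?_
        obtain ⟨l, hl, rfl⟩ := mem_map.mp hj
        have := (mem_filter.mp hl).2
        simp only [Fin.valEmbedding_apply, mem_Ico]
        omega
      _ ≤ w := by
        rw [Nat.card_Ico]
        omega
  have h := Finset.card_le_mul_card_image_of_maps_to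
    (s := univ.filter fun θ : Fin n ≃ Fin n => closeSet w θ = S)
    (t := S.pi fun i => before i ×ˢ cyclicDiffs n w) (f := code) ?_ ((n - S.card).factorial) ?_
  · refine h.trans ?_
    rw [mul_comm, Finset.card_pi]
    refine Nat.mul_le_mul_right _ (Finset.prod_le_pow_card _ _ _ fun i _ => ?_)
    rw [card_product]
    calc (before i).card * (cyclicDiffs n w).card ≤ w * (4 * w) :=
          Nat.mul_le_mul (hbefore i) (card_cyclicDiffs_le n w)
      _ = 4 * w ^ 2 := by ring
  · intro θ hθ
    simp only [mem_filter, mem_univ, true_and] at hθ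
    rw [Finset.mem_pi]
    intro i hi
    obtain ⟨h1, h2, h3⟩ := hJ θ i (hθ ▸ hi)
    rw [mem_product]
    exact ⟨mem_filter.mpr ⟨mem_univ _, h1, h2⟩, h3⟩
  · intro c hc
    refine card_le_factorial_of_increments S (fun i => if h : i ∈ S then (c i h).1 else i) ?_ _ ?_
    · intro i hi
      have := (mem_product.mp (Finset.mem_pi.mp hc i hi)).1
      simp only [hi, dite_true]
      exact (mem_filter.mp this).2.1
    · intro τ hτ τ' hτ' i hi
      have e1 : code τ i hi = c i hi := by rw [(mem_filter.mp hτ).2]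
      have e2 : code τ' i hi = c i hi := by rw [(mem_filter.mp hτ').2]
      simp only [hi, dite_true]
      have f1 : J τ i = (c i hi).1 := congrArg Prod.fst e1
      have f2 : J τ' i = (c i hi).1 := congrArg Prod.fst e2
      have g1 := congrArg Prod.snd (e1.trans e2.symm)
      simp only [code] at g1
      rwa [f1, f2] at g1

lemma sum_perm_closeSet_le (n w : ℕ) (hn : 0 < n) (K : ℝ) (hK : 0 < K)
    (hwK : 16 * Real.exp 1 * (w : ℝ) ^ 3 ≤ K) :
    ∑ θ : Fin n ≃ Fin n, 2 ^ (closeSet w θ).card *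
        ((n : ℝ) / K) ^ (followers w ((closeSet w θ).map Fin.valEmbedding)).card ≤
      n.factorial * Real.exp (16 * w ^ 2 * Real.exp 1) := by
  have hn' : (0 : ℝ) < n := by exact_mod_cast hn
  set L : ℝ := 4 * (w : ℝ) ^ 2 with hL
  have hL0 : 0 ≤ L := by positivity
  set x : ℝ := 2 * L * Real.exp 1 / K with hx
  set y : ℝ := 2 * L * Real.exp 1 / n with hy
  let f : Finset (Fin n) → ℝ := fun S =>
    2 ^ S.card * ((n : ℝ) / K) ^ (followers w (S.map Fin.valEmbedding)).card
  have hf0 : ∀ S, 0 ≤ f S := fun S => by positivity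
  have hterm : ∀ S : Finset (Fin n),
      ((univ.filter fun θ : Fin n ≃ Fin n => closeSet w θ = S).card : ℝ) * f S ≤
        n.factorial * runWeight w x y (S.map Fin.valEmbedding) := by
    intro S
    have hSn : S.card ≤ n := by simpa using Finset.card_le_univ S
    have h1 : ((univ.filter fun θ : Fin n ≃ Fin n => closeSet w θ = S).card : ℝ) ≤
        L ^ S.card * (n - S.card).factorial := by
      have := card_closeSet_eq_le w S
      rw [hL]
      exact_mod_cast this
    have h2 : ((n - S.card).factorial : ℝ) ≤ (Real.exp 1 / n) ^ S.card * n.factorial := by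
      have := pow_mul_factorial_sub_le n S.card hSn
      rw [div_pow, div_mul_eq_mul_div, le_div_iff₀ (by positivity)]
      linarith
    have hF : (followers w (S.map Fin.valEmbedding)).card ≤ S.card := by
      simpa using Finset.card_le_card (followers_subset w (S.map Fin.valEmbedding))
    obtain ⟨u, hu⟩ := Nat.exists_eq_add_of_le hF
    calc _ ≤ (L ^ S.card * ((Real.exp 1 / n) ^ S.card * n.factorial)) * f S := by
          refine mul_le_mul_of_nonneg_right (h1.trans ?_) (hf0 S)
          gcongr
      _ = n.factorial * ((2 * L * Real.exp 1 / n) ^ S.card *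
            ((n : ℝ) / K) ^ (followers w (S.map Fin.valEmbedding)).card) := by
          simp only [f, div_pow, mul_pow]
          ring
      _ = _ := by
          rw [runWeight, Finset.card_map, hu, Nat.add_sub_cancel_left, pow_add, mul_right_comm,
            ← mul_pow]
          congr 3
          rw [hx]
          field_simp
  calc _ = ∑ θ : Fin n ≃ Fin n, f (closeSet w θ) := rfl
    _ = ∑ S : Finset (Fin n), ((univ.filter fun θ : Fin n ≃ Fin n =>
          closeSet w θ = S).card : ℝ) * f S := by
        rw [← Finset.sum_fiberwise univ (closeSet w)]
        refine Finset.sum_congr rfl fun S _ => ?_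
        rw [Finset.sum_congr rfl (g := fun _ => f S)
          (fun θ hθ => by rw [(mem_filter.mp hθ).2]), Finset.sum_const, nsmul_eq_mul]
    _ ≤ ∑ S : Finset (Fin n), n.factorial * runWeight w x y (S.map Fin.valEmbedding) :=
        Finset.sum_le_sum fun S _ => hterm S
    _ = n.factorial * ∑ S ∈ univ.map (Finset.mapEmbedding (Fin.valEmbedding (n := n))).toEmbedding,
          runWeight w x y S := by
        rw [← Finset.mul_sum, Finset.sum_map]
        rfl
    _ ≤ n.factorial * ∑ S ∈ (range n).powerset, runWeight w x y S := by
        refine mul_le_mul_of_nonneg_left ?_ (by positivity)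
        refine Finset.sum_le_sum_of_subset_of_nonneg ?_ fun S _ _ =>
          runWeight_nonneg w (by positivity) (by positivity) S
        intro S hS
        obtain ⟨S, _, rfl⟩ := mem_map.mp hS
        rw [mem_powerset]
        intro i hi
        obtain ⟨i, _, rfl⟩ := mem_map.mp hi
        simp
    _ ≤ n.factorial * (1 + 2 * y) ^ n := by
        gcongr
        refine sum_runWeight_le w x y (by positivity) (by positivity) ?_ n
        rw [hx, mul_div_assoc', div_le_iff₀ hK, hL]
        linarith
    _ ≤ n.factorial * Real.exp (2 * y) ^ n := by
        gcongr
        linarith [Real.add_one_le_exp (2 * y)]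
    _ = _ := by
        rw [← Real.exp_nat_mul, hy, hL]
        congr 2
        field_simp
        ring

/-- The cyclic window of `w + 1` consecutive residues starting at `i`. -/
def residueWindow {n : ℕ} (w : ℕ) (i : ZMod n) : Finset (ZMod n) :=
  (range (w + 1)).image fun j : ℕ => i + (j : ZMod n)

lemma card_residueWindow_le {n : ℕ} (w : ℕ) (i : ZMod n) : (residueWindow w i).card ≤ w + 1 :=
  card_image_le.trans (by simp)

lemma image_add_residueWindow {n : ℕ} (w : ℕ) (i t : ZMod n) :
    (residueWindow w i).image (· + t) = residueWindow w (i + t) := by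
  ext x
  simp only [residueWindow, image_image, mem_image, Function.comp]
  exact exists_congr fun j => and_congr_right fun _ => by rw [add_right_comm]

lemma image_neg_residueWindow_subset {n : ℕ} (w : ℕ) (i : ZMod n) :
    (residueWindow w i).image (fun x => -x) ⊆ residueWindow w (-i - w) := by
  intro x hx
  simp only [residueWindow, image_image, mem_image, Function.comp, mem_range] at hx ⊢
  obtain ⟨j, hj, rfl⟩ := hx
  refine ⟨w - j, by omega, ?_⟩
  rw [Nat.cast_sub (by omega)]
  ring

lemma val_mem_Icc_of_mem_residueWindow {n w : ℕ} {i x : ZMod n} (hi : i.val + w < n)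
    (hx : x ∈ residueWindow w i) : i.val ≤ x.val ∧ x.val ≤ i.val + w := by
  simp only [residueWindow, mem_image, mem_range] at hx
  obtain ⟨j, hj, rfl⟩ := hx
  have h1 : ((j : ZMod n)).val = j := ZMod.val_natCast_of_lt (by omega)
  rw [ZMod.val_add_of_lt (by rw [h1]; omega), h1]
  omega

section Residues

variable {n : ℕ} [NeZero n]

/-- The `r`-sets of residues contained in a window of `w + 1` consecutive residues. -/
def windowSets (n r w : ℕ) [NeZero n] : Finset (Finset (ZMod n)) :=
  univ.filter fun F => F.card = r ∧ ∃ i, F ⊆ residueWindow w i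

lemma mem_windowSets {r w : ℕ} {F : Finset (ZMod n)} :
    F ∈ windowSets n r w ↔ F.card = r ∧ ∃ i, F ⊆ residueWindow w i := by
  simp [windowSets]

lemma image_add_mem_windowSets {r w : ℕ} (t : ZMod n) {F : Finset (ZMod n)}
    (hF : F ∈ windowSets n r w) : F.image (· + t) ∈ windowSets n r w := by
  rw [mem_windowSets] at hF ⊢
  obtain ⟨hc, i, hi⟩ := hF
  refine ⟨by rw [card_image_of_injective _ (add_left_injective t), hc], i + t, ?_⟩
  rw [← image_add_residueWindow]
  exact image_subset_image hi

lemma image_neg_mem_windowSets {r w : ℕ} {F : Finset (ZMod n)}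
    (hF : F ∈ windowSets n r w) : F.image (fun x => -x) ∈ windowSets n r w := by
  rw [mem_windowSets] at hF ⊢
  obtain ⟨hc, i, hi⟩ := hF
  exact ⟨by rw [card_image_of_injective _ neg_injective, hc], _,
    (image_subset_image hi).trans (image_neg_residueWindow_subset w i)⟩

/-- The window sets mapped to window sets by `θ`. -/
def sharedSets (r w : ℕ) (θ : Equiv.Perm (ZMod n)) : Finset (Finset (ZMod n)) :=
  (windowSets n r w).filter fun F => F.image θ ∈ windowSets n r w

/-- `F` lies in a window which does not wrap around. -/
def IsStraight (w : ℕ) (F : Finset (ZMod n)) : Prop :=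
  ∃ i : ZMod n, i.val + w < n ∧ F ⊆ residueWindow w i

lemma val_sub_val_mem_cyclicDiffs {w : ℕ} (hw : w < n) {c x y : ZMod n} (hxy : x ≠ y)
    (hx : x ∈ residueWindow w c) (hy : y ∈ residueWindow w c) :
    ((x.val : ℤ) - y.val) ∈ cyclicDiffs n w := by
  simp only [residueWindow, mem_image, mem_range] at hx hy
  obtain ⟨j, hj, hx⟩ := hx
  obtain ⟨l, hl, hy⟩ := hy
  have hxv := ZMod.val_lt x
  have hyv := ZMod.val_lt y
  have hne : x.val ≠ y.val := fun h => hxy (ZMod.val_injective n h)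
  have hdvd : (n : ℤ) ∣ ((x.val : ℤ) - y.val) - ((j : ℤ) - l) := by
    rw [← ZMod.intCast_zmod_eq_zero_iff_dvd]
    push_cast
    rw [ZMod.natCast_zmod_val, ZMod.natCast_zmod_val, ← hx, ← hy]
    ring
  obtain ⟨q, hq⟩ := hdvd
  have hn : (0 : ℤ) < n := by omega
  have h1 : q < 2 := by
    by_contra h
    have : (n : ℤ) * 2 ≤ n * q := mul_le_mul_of_nonneg_left (by omega) hn.le
    omega
  have h2 : -2 < q := by
    by_contra h
    have : (n : ℤ) * q ≤ n * (-2) := mul_le_mul_of_nonneg_left (by omega) hn.le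
    omega
  simp only [cyclicDiffs, mem_filter, mem_Ioo]
  obtain rfl | rfl | rfl : q = -1 ∨ q = 0 ∨ q = 1 := by omega
  all_goals
    refine ⟨by omega, by omega, ?_⟩
    rcases abs_cases ((x.val : ℤ) - y.val) with ⟨h, _⟩ | ⟨h, _⟩ <;> rw [h] <;> omega

/-- Residues modulo `n` as elements of `Fin n`, via their least representatives. -/
def residueEquivFin (n : ℕ) [NeZero n] : ZMod n ≃ Fin n where
  toFun x := ⟨x.val, ZMod.val_lt x⟩
  invFun i := ((i : ℕ) : ZMod n)
  left_inv x := by simp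
  right_inv i := Fin.ext (ZMod.val_natCast_of_lt i.isLt)

/-- `closeSet` of a permutation of the residues, as a set of natural numbers. -/
def closeVals (w : ℕ) (θ : Equiv.Perm (ZMod n)) : Finset ℕ :=
  (closeSet w ((residueEquivFin n).permCongr θ)).map Fin.valEmbedding

lemma mem_closeVals_of_shared {r w : ℕ} (hw : w < n) {θ : Equiv.Perm (ZMod n)}
    {F : Finset (ZMod n)} (hF : F ∈ sharedSets r w θ) {x y : ZMod n} (hx : x ∈ F) (hy : y ∈ F)
    (hlt : x.val < y.val) (hle : y.val ≤ x.val + w) : y.val ∈ closeVals w θ := by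
  obtain ⟨-, c, hc⟩ := mem_windowSets.mp (mem_filter.mp hF).2
  have hxy : θ y ≠ θ x := fun h => by
    rw [θ.injective h] at hlt
    omega
  have h := val_sub_val_mem_cyclicDiffs hw hxy (hc (mem_image_of_mem θ hy))
    (hc (mem_image_of_mem θ hx))
  refine mem_map.mpr ⟨residueEquivFin n y, mem_filter.mpr ⟨mem_univ _, residueEquivFin n x,
    hlt, hle, ?_⟩, rfl⟩
  simp only [Equiv.permCongr_apply, Equiv.symm_apply_apply]
  exact h

lemma card_straight_sharedSets_le {r w : ℕ} (hr : 3 ≤ r) (hw : w < n) (θ : Equiv.Perm (ZMod n)) :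
    ((sharedSets r w θ).filter (IsStraight w)).card ≤
      w.choose (r - 1) * (followers w (closeVals w θ)).card := by
  have hinj : Function.Injective fun F : Finset (ZMod n) => F.image ZMod.val :=
    Finset.image_injective (ZMod.val_injective n)
  rw [← Finset.card_image_of_injective _ hinj, mul_comm]
  have hsub : ((sharedSets r w θ).filter (IsStraight w)).image (fun F => F.image ZMod.val) ⊆
      (followers w (closeVals w θ)).biUnion fun i =>
        (powersetCard (r - 1) (Ico (i - w) i)).image (insert i) := by
    intro G hG
    obtain ⟨F, hF, rfl⟩ := mem_image.mp hG
    obtain ⟨hF, a, haw, haF⟩ := mem_filter.mp hF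
    set G := F.image ZMod.val with hGdef
    have hcard : G.card = r := by
      rw [hGdef, card_image_of_injective _ (ZMod.val_injective n)]
      exact (mem_windowSets.mp (mem_filter.mp hF).1).1
    have hIcc : ∀ b ∈ G, a.val ≤ b ∧ b ≤ a.val + w := by
      intro b hb
      obtain ⟨x, hx, rfl⟩ := mem_image.mp hb
      exact val_mem_Icc_of_mem_residueWindow haw (haF hx)
    have hclose : ∀ b ∈ G, ∀ c ∈ G, b < c → c ∈ closeVals w θ := by
      intro b hb c hc hbc
      have h1 := hIcc b hb
      have h2 := hIcc c hc
      obtain ⟨x, hx, rfl⟩ := mem_image.mp hb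
      obtain ⟨y, hy, rfl⟩ := mem_image.mp hc
      exact mem_closeVals_of_shared hw hF hx hy hbc (by omega)
    have hne : G.Nonempty := card_pos.mp (by omega)
    have hi := G.max'_mem hne
    set i := G.max' hne
    have hlt : ∀ b ∈ G.erase i, b < i := fun b hb =>
      lt_of_le_of_ne (G.le_max' b (mem_of_mem_erase hb)) (ne_of_mem_erase hb)
    have hc1 : (G.erase i).card = r - 1 := by rw [card_erase_of_mem hi, hcard]
    have hne1 : (G.erase i).Nonempty := card_pos.mp (by omega)
    have hj := (G.erase i).max'_mem hne1
    set j := (G.erase i).max' hne1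
    have hc2 : ((G.erase i).erase j).card = r - 2 := by
      rw [card_erase_of_mem hj, hc1]
      omega
    obtain ⟨l, hl⟩ := card_pos.mp (show 0 < ((G.erase i).erase j).card by omega)
    have hl' := mem_of_mem_erase hl
    have hlj : l < j := lt_of_le_of_ne ((G.erase i).le_max' l hl') (ne_of_mem_erase hl)
    have hjG := mem_of_mem_erase hj
    have hji := hlt j hj
    refine mem_biUnion.mpr ⟨i, mem_filter.mpr ⟨hclose j hjG i hi hji, j,
      hclose l (mem_of_mem_erase hl') j hjG hlj, hji, ?_⟩, mem_image.mpr ⟨G.erase i,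
      mem_powersetCard.mpr ⟨?_, hc1⟩, insert_erase hi⟩⟩
    · have := hIcc i hi
      have := hIcc j hjG
      omega
    · intro b hb
      have := hIcc i hi
      have := hIcc b (mem_of_mem_erase hb)
      have := hlt b hb
      rw [mem_Ico]
      omega
  refine (card_le_card hsub).trans (card_biUnion_le_card_mul _ _ _ fun i _ => ?_)
  refine card_image_le.trans ?_
  rw [card_powersetCard, Nat.card_Ico]
  exact Nat.choose_le_choose _ (by omega)

lemma card_filter_le_val (w : ℕ) : (univ.filter fun i : ZMod n => n ≤ i.val + w).card ≤ w := by
  rw [← card_image_of_injective _ (ZMod.val_injective n)]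
  calc _ ≤ (Ico (n - w) n).card := by
        refine card_le_card fun b hb => ?_
        obtain ⟨i, hi, rfl⟩ := mem_image.mp hb
        have := (mem_filter.mp hi).2
        have := ZMod.val_lt i
        rw [mem_Ico]
        omega
    _ ≤ w := by
        rw [Nat.card_Ico]
        omega

lemma card_not_straight_sharedSets_le (r w : ℕ) (θ : Equiv.Perm (ZMod n)) :
    ((sharedSets r w θ).filter fun F => ¬ IsStraight w F).card ≤ w * 2 ^ (w + 1) := by
  have hsub : ((sharedSets r w θ).filter fun F => ¬ IsStraight w F) ⊆
      (univ.filter fun i : ZMod n => n ≤ i.val + w).biUnion fun i =>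
        (residueWindow w i).powerset := by
    intro F hF
    obtain ⟨hF, hs⟩ := mem_filter.mp hF
    obtain ⟨-, i, hi⟩ := mem_windowSets.mp (mem_filter.mp hF).1
    refine mem_biUnion.mpr ⟨i, mem_filter.mpr ⟨mem_univ _, ?_⟩, mem_powerset.mpr hi⟩
    by_contra h
    exact hs ⟨i, by omega, hi⟩
  refine (card_le_card hsub).trans ((card_biUnion_le_card_mul _ _ (2 ^ (w + 1)) ?_).trans ?_)
  · intro i _
    rw [card_powerset]
    exact Nat.pow_le_pow_right (by norm_num) (card_residueWindow_le w i)
  · exact Nat.mul_le_mul_right _ (card_filter_le_val w)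

lemma card_sharedSets_le {r w : ℕ} (hr : 3 ≤ r) (hw : w < n) (θ : Equiv.Perm (ZMod n)) :
    (sharedSets r w θ).card ≤
      w.choose (r - 1) * (followers w (closeVals w θ)).card + w * 2 ^ (w + 1) := by
  rw [← card_filter_add_card_filter_not (s := sharedSets r w θ) (IsStraight w)]
  exact Nat.add_le_add (card_straight_sharedSets_le hr hw θ)
    (card_not_straight_sharedSets_le r w θ)

/-- Rotations after which all window sets shared by `θ` are straight. -/
def goodShifts (r w : ℕ) (θ : Equiv.Perm (ZMod n)) : Finset (ZMod n) :=
  univ.filter fun t => ∀ F ∈ sharedSets r w θ, IsStraight w (F.image (· + -t))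

lemma le_card_goodShifts (r w : ℕ) (θ : Equiv.Perm (ZMod n)) :
    n ≤ (goodShifts r w θ).card + (sharedSets r w θ).card * w := by
  have hsub : (goodShifts r w θ)ᶜ ⊆ (sharedSets r w θ).biUnion fun F =>
      univ.filter fun t => ¬ IsStraight w (F.image (· + -t)) := by
    intro t ht
    simp only [goodShifts, mem_compl, mem_filter, mem_univ, true_and, not_forall] at ht
    obtain ⟨F, hF, h⟩ := ht
    exact mem_biUnion.mpr ⟨F, hF, by simpa using h⟩
  have h := (card_le_card hsub).trans (card_biUnion_le_card_mul _ _ w ?_)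
  · rw [card_compl, ZMod.card] at h
    omega
  · intro F hF
    obtain ⟨-, i, hi⟩ := mem_windowSets.mp (mem_filter.mp hF).1
    refine le_trans ?_ (card_filter_le_val (n := n) w)
    refine card_le_card_of_injOn (fun t => i + -t) ?_ ?_
    · intro t ht
      have ht := (mem_filter.mp ht).2
      refine mem_filter.mpr ⟨mem_univ _, ?_⟩
      by_contra hcon
      simp only [not_le] at hcon
      refine ht ⟨i + -t, hcon, ?_⟩
      rw [← image_add_residueWindow]
      exact image_subset_image hi
    · intro t _ t' _ h
      simpa using h

lemma card_sharedSets_le_of_good {r w : ℕ} (hr : 3 ≤ r) (hw : w < n) {θ : Equiv.Perm (ZMod n)}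
    {t : ZMod n} (ht : t ∈ goodShifts r w θ) :
    (sharedSets r w θ).card ≤
      w.choose (r - 1) * (followers w (closeVals w ((Equiv.addRight t).trans θ))).card := by
  refine le_trans ?_ (card_straight_sharedSets_le hr hw _)
  refine card_le_card_of_injOn (fun F => F.image (· + -t)) ?_
    ((Finset.image_injective (add_left_injective (-t))).injOn)
  intro F hF
  have hF' := mem_filter.mp hF
  refine mem_filter.mpr ⟨mem_filter.mpr ⟨image_add_mem_windowSets _ hF'.1, ?_⟩,
    (mem_filter.mp ht).2 F hF⟩
  rw [image_image]
  convert hF'.2 using 2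
  ext x
  simp

lemma sum_perm_closeVals_le (n w : ℕ) [NeZero n] (K : ℝ) (hK : 0 < K)
    (hwK : 16 * Real.exp 1 * (w : ℝ) ^ 3 ≤ K) :
    ∑ θ : Equiv.Perm (ZMod n), 2 ^ (closeVals w θ).card *
        ((n : ℝ) / K) ^ (followers w (closeVals w θ)).card ≤
      n.factorial * Real.exp (16 * w ^ 2 * Real.exp 1) := by
  refine le_trans (le_of_eq ?_) (sum_perm_closeSet_le n w (Nat.pos_of_ne_zero (NeZero.ne n)) K hK hwK)
  rw [← Equiv.sum_comp (residueEquivFin n).permCongr]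
  refine Finset.sum_congr rfl fun θ _ => ?_
  rw [closeVals, card_map]

lemma exists_forall_pow_le_two_pow (a b : ℕ) (hb : 0 < b) :
    ∃ N : ℕ, ∀ n ≥ N, ∀ c : ℕ, n ≤ b * c → (n : ℝ) ^ a ≤ 2 ^ c := by
  have h := (isLittleO_pow_const_const_pow_of_one_lt (R := ℝ) (a * b) (r := 2) (by norm_num)).bound
    (c := 1) one_pos
  obtain ⟨N, hN⟩ := Filter.eventually_atTop.mp h
  refine ⟨N, fun n hn c hc => ?_⟩
  have h1 := hN n hn
  simp only [Real.norm_eq_abs, one_mul] at h1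
  rw [abs_of_nonneg (by positivity), abs_of_nonneg (by positivity)] at h1
  refine le_of_pow_le_pow_left₀ hb.ne' (by positivity) ?_
  rw [← pow_mul, ← pow_mul]
  refine h1.trans (pow_le_pow_right₀ (by norm_num) ?_)
  rw [mul_comm]
  exact hc

lemma exists_forall_sum_sharedSets_le {r w : ℕ} (hr : 3 ≤ r) (hrw : r - 1 ≤ w) :
    ∃ N : ℕ, ∀ n ≥ N, ∀ [NeZero n], ∀ K P : ℝ, 1 ≤ K → 16 * Real.exp 1 * (w : ℝ) ^ 3 ≤ K → 1 ≤ P →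
      P ^ w.choose (r - 1) = n / K →
      ∑ θ : Equiv.Perm (ZMod n), P ^ (sharedSets r w θ).card ≤
        3 * Real.exp (16 * w ^ 2 * Real.exp 1) * n.factorial := by
  set d := w.choose (r - 1) with hd
  have hd0 : 0 < d := Nat.choose_pos hrw
  have hw0 : 0 < w := by omega
  set A := w * 2 ^ (w + 1) with hA
  obtain ⟨N, hN⟩ := exists_forall_pow_le_two_pow A (4 * (w * d)) (by positivity)
  refine ⟨max N (max (w + 1) (4 * (w * A))), fun n hn _ K P hK hwK hP hPd => ?_⟩
  have hnN : N ≤ n := le_of_max_le_left hn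
  have hnw : w < n := le_of_max_le_left (le_of_max_le_right hn)
  have hnA : 4 * (w * A) ≤ n := le_of_max_le_right (le_of_max_le_right hn)
  have hn0 : (0 : ℝ) < n := by exact_mod_cast (by omega : 0 < n)
  have hPn : P ≤ n := by
    calc P ≤ P ^ d := le_self_pow₀ hP hd0.ne'
      _ = n / K := hPd
      _ ≤ n := div_le_self hn0.le hK
  let Z : Equiv.Perm (ZMod n) → ℝ := fun θ =>
    2 ^ (closeVals w θ).card * ((n : ℝ) / K) ^ (followers w (closeVals w θ)).card
  have hZ0 : ∀ θ, 0 ≤ Z θ := fun θ => by positivity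
  have hpoint : ∀ θ : Equiv.Perm (ZMod n), P ^ (sharedSets r w θ).card ≤
      Z θ + 2 / n * ∑ t : ZMod n, Z ((Equiv.addRight t).trans θ) := by
    intro θ
    have hFA := card_le_card (followers_subset w (closeVals w θ))
    have hb := card_sharedSets_le hr hnw θ
    rw [← hd, ← hA] at hb
    have hs0 : 0 ≤ ∑ t : ZMod n, Z ((Equiv.addRight t).trans θ) := Finset.sum_nonneg fun _ _ => hZ0 _
    by_cases hcase : n ≤ 4 * (w * d) * (closeVals w θ).card
    · have h2 := hN n hnN _ hcase
      have : P ^ (sharedSets r w θ).card ≤ Z θ := by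
        calc P ^ (sharedSets r w θ).card
            ≤ P ^ (d * (followers w (closeVals w θ)).card + A) := pow_le_pow_right₀ hP hb
          _ = P ^ A * ((n : ℝ) / K) ^ (followers w (closeVals w θ)).card := by
            rw [pow_add, pow_mul, hPd, mul_comm]
          _ ≤ 2 ^ (closeVals w θ).card * ((n : ℝ) / K) ^ (followers w (closeVals w θ)).card := by
            refine mul_le_mul_of_nonneg_right ?_ (by positivity)
            exact (pow_le_pow_left₀ (by linarith) hPn A).trans h2
      have : 0 ≤ 2 / (n : ℝ) * ∑ t : ZMod n, Z ((Equiv.addRight t).trans θ) := by positivity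
      linarith
    · have hg := le_card_goodShifts r w θ
      have hg2 : n ≤ 2 * (goodShifts r w θ).card := by
        have h1 : (sharedSets r w θ).card * w ≤ (d * (closeVals w θ).card + A) * w :=
          Nat.mul_le_mul_right _ (hb.trans (by gcongr))
        have h2 : (d * (closeVals w θ).card + A) * w = (w * d) * (closeVals w θ).card + w * A := by
          ring
        have h3 : 4 * (w * d) * (closeVals w θ).card = 4 * ((w * d) * (closeVals w θ).card) := by
          ring
        omega
      have hg3 : (n : ℝ) ≤ 2 * (goodShifts r w θ).card := by exact_mod_cast hg2
      have hP0 : 0 ≤ P ^ (sharedSets r w θ).card := by positivity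
      have h4 : ((goodShifts r w θ).card : ℝ) * P ^ (sharedSets r w θ).card ≤
          ∑ t : ZMod n, Z ((Equiv.addRight t).trans θ) := by
        rw [← nsmul_eq_mul]
        refine (Finset.card_nsmul_le_sum _ (fun t => Z ((Equiv.addRight t).trans θ)) _ ?_).trans
          (Finset.sum_le_univ_sum_of_nonneg fun _ => hZ0 _)
        intro t ht
        calc P ^ (sharedSets r w θ).card ≤ P ^ (d * _) :=
              pow_le_pow_right₀ hP (card_sharedSets_le_of_good hr hnw ht)
          _ = ((n : ℝ) / K) ^ (followers w (closeVals w ((Equiv.addRight t).trans θ))).card := by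
            rw [pow_mul, hPd]
          _ ≤ _ := le_mul_of_one_le_left (by positivity) (one_le_pow₀ (by norm_num))
      have h5 : P ^ (sharedSets r w θ).card ≤
          2 / n * ∑ t : ZMod n, Z ((Equiv.addRight t).trans θ) := by
        rw [div_mul_eq_mul_div, le_div_iff₀ hn0]
        nlinarith
      linarith [hZ0 θ]
  have hZ : ∑ θ, Z θ ≤ n.factorial * Real.exp (16 * w ^ 2 * Real.exp 1) :=
    sum_perm_closeVals_le n w K (by linarith) hwK
  have hshift : ∀ t : ZMod n, ∑ θ, Z ((Equiv.addRight t).trans θ) = ∑ θ, Z θ := fun t =>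
    Equiv.sum_comp (Equiv.mulRight (Equiv.addRight t : Equiv.Perm (ZMod n))) Z
  calc _ ≤ ∑ θ, (Z θ + 2 / n * ∑ t : ZMod n, Z ((Equiv.addRight t).trans θ)) :=
        Finset.sum_le_sum fun θ _ => hpoint θ
    _ = 3 * ∑ θ, Z θ := by
        rw [Finset.sum_add_distrib, ← Finset.mul_sum, Finset.sum_comm]
        simp only [hshift, Finset.sum_const, card_univ, ZMod.card, nsmul_eq_mul]
        field_simp
        ring
    _ ≤ _ := by linarith

end Residues

lemma expct_indicator {n r : ℕ} (p : ℝ) {A : Finset (Finset (Fin n))} (hA : A ⊆ rSets n r) :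
    expct n r p (fun H => if A ⊆ H then 1 else 0) = p ^ A.card := by
  have hIcc : (rSets n r).powerset.filter (A ⊆ ·) = Finset.Icc A (rSets n r) := by
    ext H
    simp [and_comm]
  simp only [expct, mul_ite, mul_one, mul_zero]
  rw [← Finset.sum_filter, hIcc, Finset.Icc_eq_image_powerset hA, Finset.sum_image]
  · have hc := Finset.card_sdiff_of_subset hA
    have hterm : ∀ B ∈ (rSets n r \ A).powerset, prW n r p (A ∪ B) =
        p ^ A.card * (p ^ B.card * (1 - p) ^ ((rSets n r \ A).card - B.card)) := by
      intro B hB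
      have hd : Disjoint A B := disjoint_sdiff.mono_right (mem_powerset.mp hB)
      rw [prW, card_union_of_disjoint hd, hc, pow_add, mul_assoc, Nat.sub_sub]
    rw [Finset.sum_congr rfl hterm, ← Finset.mul_sum, Finset.sum_pow_mul_eq_add_pow]
    simp
  · intro B hB B' hB' h
    have hd : Disjoint A B := disjoint_sdiff.mono_right (mem_powerset.mp hB)
    have hd' : Disjoint A B' := disjoint_sdiff.mono_right (mem_powerset.mp hB')
    have h : A ∪ B = A ∪ B' := h
    rw [← union_sdiff_cancel_left hd, h, union_sdiff_cancel_left hd']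

lemma expct_sum {ι : Type*} (s : Finset ι) (n r : ℕ) (p : ℝ)
    (f : ι → Finset (Finset (Fin n)) → ℝ) :
    expct n r p (fun H => ∑ i ∈ s, f i H) = ∑ i ∈ s, expct n r p (f i) := by
  simp only [expct, Finset.mul_sum]
  exact Finset.sum_comm

lemma hamPowEdges_subset_rSets (r k n : ℕ) (σ : ZMod n → Fin n) :
    hamPowEdges r k n σ ⊆ rSets n r := fun _ he =>
  mem_filter.mpr ⟨mem_univ _, (mem_filter.mp he).2.1⟩

/-- The cyclic ordering `σ` started at position `t`, reversed if `s = false`. -/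
def dihedralShift {n : ℕ} (σ : ZMod n → Fin n) (t : ZMod n) (s : Bool) : ZMod n → Fin n :=
  fun x => σ (if s then x - t else t - x)

lemma bijective_dihedralShift {n : ℕ} {σ : ZMod n → Fin n} (hσ : Function.Bijective σ) (t : ZMod n)
    (s : Bool) : Function.Bijective (dihedralShift σ t s) := by
  cases s
  · exact hσ.comp (Equiv.subLeft t).bijective
  · exact hσ.comp (Equiv.subRight t).bijective

lemma cycWindow_eq_image {n r k : ℕ} (hk : 1 ≤ k) (hr : 1 ≤ r) (σ : ZMod n → Fin n) (i : ZMod n) :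
    cycWindow k r n σ i = (residueWindow (k + r - 2) i).image σ := by
  have h : k + r - 1 = k + r - 2 + 1 := by omega
  rw [cycWindow, residueWindow, h]
  ext x
  simp

section CyclicOrderings

variable {n : ℕ} [NeZero n]

/-- The canonical representatives of the cyclic orderings of `[n]`. -/
def cycReps (n : ℕ) [NeZero n] : Finset (ZMod n → Fin n) := univ.filter (IsCycRep n)

lemma XH_eq_sum (r k : ℕ) (H : Finset (Finset (Fin n))) :
    XH r k n H = ∑ σ ∈ cycReps n, if hamPowEdges r k n σ ⊆ H then 1 else 0 := by
  rw [XH, Nat.card_eq_fintype_card, Fintype.card_subtype, Finset.sum_boole, cycReps, filter_filter]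

lemma expct_XH (r k : ℕ) (p : ℝ) :
    expct n r p (XH r k n) = ∑ σ ∈ cycReps n, p ^ (hamPowEdges r k n σ).card := by
  rw [funext (XH_eq_sum (n := n) r k), expct_sum]
  exact Finset.sum_congr rfl fun σ _ => expct_indicator p (hamPowEdges_subset_rSets r k n σ)

lemma expct_XH_sq (r k : ℕ) (p : ℝ) :
    expct n r p (fun H => XH r k n H ^ 2) = ∑ σ ∈ cycReps n, ∑ τ ∈ cycReps n,
      p ^ (hamPowEdges r k n σ ∪ hamPowEdges r k n τ).card := by
  have h : (fun H => XH r k n H ^ 2) = fun H => ∑ σ ∈ cycReps n, ∑ τ ∈ cycReps n,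
      if hamPowEdges r k n σ ∪ hamPowEdges r k n τ ⊆ H then (1 : ℝ) else 0 := by
    funext H
    rw [XH_eq_sum, sq, Finset.sum_mul_sum]
    refine Finset.sum_congr rfl fun σ _ => Finset.sum_congr rfl fun τ _ => ?_
    by_cases h1 : hamPowEdges r k n σ ⊆ H <;> by_cases h2 : hamPowEdges r k n τ ⊆ H <;>
      simp [union_subset_iff, h1, h2]
  rw [h, expct_sum]
  refine Finset.sum_congr rfl fun σ _ => ?_
  rw [expct_sum]
  exact Finset.sum_congr rfl fun τ _ => expct_indicator p
    (union_subset (hamPowEdges_subset_rSets r k n σ) (hamPowEdges_subset_rSets r k n τ))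

lemma hamPowEdges_eq_image {r k : ℕ} (hk : 1 ≤ k) (hr : 1 ≤ r) {σ : ZMod n → Fin n}
    (hσ : Function.Bijective σ) :
    hamPowEdges r k n σ = (windowSets n r (k + r - 2)).image (fun F => F.image σ) := by
  ext e
  simp only [hamPowEdges, mem_filter, mem_univ, true_and, mem_image, mem_windowSets,
    cycWindow_eq_image hk hr]
  constructor
  · rintro ⟨hc, i, hi⟩
    obtain ⟨F, hF, rfl⟩ := subset_image_iff.mp hi
    exact ⟨F, ⟨by rwa [card_image_of_injective _ hσ.1] at hc, i, hF⟩, rfl⟩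
  · rintro ⟨F, ⟨hc, i, hi⟩, rfl⟩
    exact ⟨by rwa [card_image_of_injective _ hσ.1], i, image_subset_image hi⟩

lemma card_hamPowEdges {r k : ℕ} (hk : 1 ≤ k) (hr : 1 ≤ r) {σ : ZMod n → Fin n}
    (hσ : Function.Bijective σ) :
    (hamPowEdges r k n σ).card = (windowSets n r (k + r - 2)).card := by
  rw [hamPowEdges_eq_image hk hr hσ, card_image_of_injective _ (Finset.image_injective hσ.1)]

lemma card_hamPowEdges_inter_le {r k : ℕ} (hk : 1 ≤ k) (hr : 1 ≤ r) (σ τ : ZMod n ≃ Fin n) :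
    (hamPowEdges r k n σ ∩ hamPowEdges r k n τ).card ≤
      (sharedSets r (k + r - 2) (τ.trans σ.symm)).card := by
  refine le_trans (card_le_card (t := (sharedSets r (k + r - 2) (τ.trans σ.symm)).image
    fun F => F.image τ) ?_) card_image_le
  intro e he
  rw [mem_inter, hamPowEdges_eq_image hk hr σ.bijective, hamPowEdges_eq_image hk hr τ.bijective,
    mem_image, mem_image] at he
  obtain ⟨⟨G, hG, hGe⟩, F, hF, rfl⟩ := he
  refine mem_image.mpr ⟨F, mem_filter.mpr ⟨hF, ?_⟩, rfl⟩
  have : F.image (τ.trans σ.symm) = G := by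
    rw [Equiv.coe_trans, ← image_image, ← hGe, image_image]
    simp
  rwa [this]

lemma hamPowEdges_subset_dihedralShift {r k : ℕ} (hk : 1 ≤ k) (hr : 1 ≤ r) {σ : ZMod n → Fin n}
    (hσ : Function.Bijective σ) (t : ZMod n) (s : Bool) :
    hamPowEdges r k n σ ⊆ hamPowEdges r k n (dihedralShift σ t s) := by
  rw [hamPowEdges_eq_image hk hr hσ, hamPowEdges_eq_image hk hr (bijective_dihedralShift hσ t s)]
  intro e he
  obtain ⟨F, hF, rfl⟩ := mem_image.mp he
  cases s
  · refine mem_image.mpr ⟨(F.image (fun x => -x)).image (· + t),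
      image_add_mem_windowSets t (image_neg_mem_windowSets hF), ?_⟩
    rw [image_image, image_image]
    congr 1
    ext x
    simp [dihedralShift]
  · refine mem_image.mpr ⟨F.image (· + t), image_add_mem_windowSets t hF, ?_⟩
    rw [image_image]
    congr 1
    ext x
    simp [dihedralShift]

lemma dihedralShift_injOn :
    Set.InjOn (fun q : (ZMod n → Fin n) × ZMod n × Bool => dihedralShift q.1 q.2.1 q.2.2)
      ↑(cycReps n ×ˢ (univ : Finset (ZMod n × Bool))) := by
  rintro ⟨τ, t, s⟩ hq ⟨τ', t', s'⟩ hq' h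
  obtain ⟨hbij, h0, h1⟩ := (mem_filter.mp (mem_product.mp (mem_coe.mp hq)).1).2
  obtain ⟨hbij', h0', h1'⟩ := (mem_filter.mp (mem_product.mp (mem_coe.mp hq')).1).2
  have h : ∀ x, τ (if s then x - t else t - x) = τ' (if s' then x - t' else t' - x) :=
    fun x => congrFun h x
  have ht : t = t' := by
    have h2 := h t
    simp only [sub_self, ite_self] at h2
    have h3 : τ' 0 = τ' (if s' then t - t' else t' - t) := by
      rw [← h2]
      exact Fin.ext (h0'.trans h0.symm)
    have h4 := hbij'.1 h3
    split_ifs at h4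
    · exact sub_eq_zero.mp h4.symm
    · exact (sub_eq_zero.mp h4.symm).symm
  subst ht
  have hplus := h (t + 1)
  have hminus := h (t - 1)
  have hx := fun x => h (t + x)
  have hy := fun x => h (t - x)
  cases s <;> cases s' <;>
    simp only [Bool.false_eq_true, if_true, if_false, add_sub_cancel_left, sub_sub_cancel,
      sub_add_cancel_left, sub_sub_cancel_left] at hplus hminus hx hy
  · rw [funext hy]
  · simp only [hplus, hminus] at h1
    exact absurd h1 (lt_asymm h1')
  · simp only [hplus, hminus] at h1
    exact absurd h1 (lt_asymm h1')
  · rw [funext hx]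

lemma exists_dihedralShift_eq (hn : 3 ≤ n) {σ : ZMod n → Fin n} (hσ : Function.Bijective σ) :
    ∃ τ ∈ cycReps n, ∃ t s, dihedralShift τ t s = σ := by
  obtain ⟨t, ht⟩ := hσ.2 ⟨0, by omega⟩
  have h2 : (2 : ZMod n) ≠ 0 := by
    intro h
    have h' : ((2 : ℕ) : ZMod n) = 0 := by exact_mod_cast h
    rw [ZMod.natCast_eq_zero_iff] at h'
    exact absurd (Nat.le_of_dvd (by norm_num) h') (by omega)
  have hne : (σ (t + 1)).val ≠ (σ (t - 1)).val := by
    intro h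
    apply h2
    have := hσ.1 (Fin.ext h)
    linear_combination this
  have ht0 : (σ t).val = 0 := by rw [ht]
  rcases lt_or_gt_of_ne hne with hlt | hlt
  · refine ⟨fun x => σ (t + x), mem_filter.mpr ⟨mem_univ _,
      hσ.comp (Equiv.addLeft t).bijective, by simpa using ht0, ?_⟩, t, true, ?_⟩
    · simpa [← sub_eq_add_neg] using hlt
    · funext x
      simp [dihedralShift]
  · refine ⟨fun x => σ (t - x), mem_filter.mpr ⟨mem_univ _,
      hσ.comp (Equiv.subLeft t).bijective, by simpa using ht0, ?_⟩, t, false, ?_⟩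
    · simpa using hlt
    · funext x
      simp [dihedralShift]

lemma factorial_le_card_cycReps (hn : 3 ≤ n) : n.factorial ≤ 2 * n * (cycReps n).card := by
  calc n.factorial = Fintype.card (ZMod n ≃ Fin n) := by
        rw [Fintype.card_equiv (residueEquivFin n), ZMod.card]
    _ = ((univ : Finset (ZMod n ≃ Fin n)).image (fun e : ZMod n ≃ Fin n => (e : ZMod n → Fin n))).card := by
        rw [card_image_of_injective _ Equiv.coe_fn_injective, card_univ]
    _ ≤ ((cycReps n ×ˢ (univ : Finset (ZMod n × Bool))).image
          fun q => dihedralShift q.1 q.2.1 q.2.2).card := by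
        refine card_le_card fun σ hσ => ?_
        obtain ⟨e, -, rfl⟩ := mem_image.mp hσ
        obtain ⟨τ, hτ, t, s, h⟩ := exists_dihedralShift_eq hn e.bijective
        exact mem_image.mpr ⟨(τ, t, s), mem_product.mpr ⟨hτ, mem_univ _⟩, h⟩
    _ ≤ _ := by
        refine card_image_le.trans (le_of_eq ?_)
        rw [card_product, card_univ, Fintype.card_prod, ZMod.card, Fintype.card_bool]
        ring

lemma sum_cycReps_le (f : (ZMod n → Fin n) → ℝ) (hf0 : ∀ σ, 0 ≤ f σ)
    (hf : ∀ σ, Function.Bijective σ → ∀ t s, f σ ≤ f (dihedralShift σ t s)) :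
    2 * n * ∑ σ ∈ cycReps n, f σ ≤ ∑ e : ZMod n ≃ Fin n, f e := by
  have hbij : ∀ σ ∈ cycReps n, Function.Bijective σ := fun σ hσ => (mem_filter.mp hσ).2.1
  calc 2 * n * ∑ σ ∈ cycReps n, f σ
      = ∑ q ∈ cycReps n ×ˢ (univ : Finset (ZMod n × Bool)), f q.1 := by
        rw [Finset.sum_product, Finset.mul_sum]
        refine Finset.sum_congr rfl fun σ _ => ?_
        simp only [Finset.sum_const, card_univ, Fintype.card_prod, ZMod.card, Fintype.card_bool,
          nsmul_eq_mul]
        push_cast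
        ring
    _ ≤ ∑ q ∈ cycReps n ×ˢ (univ : Finset (ZMod n × Bool)), f (dihedralShift q.1 q.2.1 q.2.2) :=
        Finset.sum_le_sum fun q hq => hf _ (hbij _ (mem_product.mp hq).1) _ _
    _ = ∑ σ ∈ (cycReps n ×ˢ (univ : Finset (ZMod n × Bool))).image
          (fun q => dihedralShift q.1 q.2.1 q.2.2), f σ :=
        (Finset.sum_image dihedralShift_injOn).symm
    _ ≤ ∑ σ ∈ (univ : Finset (ZMod n ≃ Fin n)).image (fun e : ZMod n ≃ Fin n => (e : ZMod n → Fin n)), f σ := by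
        refine Finset.sum_le_sum_of_subset_of_nonneg ?_ fun σ _ _ => hf0 σ
        intro σ hσ
        obtain ⟨q, hq, rfl⟩ := mem_image.mp hσ
        exact mem_image.mpr ⟨Equiv.ofBijective _ (bijective_dihedralShift
          (hbij _ (mem_product.mp hq).1) q.2.1 q.2.2), mem_univ _, rfl⟩
    _ = _ := Finset.sum_image Equiv.coe_fn_injective.injOn

lemma expct_XH_sq_le {r k : ℕ} (hr : 1 ≤ r) (hk : 1 ≤ k) (hn : 3 ≤ n) {p D : ℝ} (hp : 0 < p)
    (hp1 : p ≤ 1) (hD : 0 ≤ D)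
    (h : ∑ θ : Equiv.Perm (ZMod n), p⁻¹ ^ (sharedSets r (k + r - 2) θ).card ≤ D * n.factorial) :
    expct n r p (fun H => XH r k n H ^ 2) ≤ D * expct n r p (XH r k n) ^ 2 := by
  have hbij : ∀ σ ∈ cycReps n, Function.Bijective σ := fun σ hσ => (mem_filter.mp hσ).2.1
  have hP : 1 ≤ p⁻¹ := (one_le_inv₀ hp).mpr hp1
  set m := (windowSets n r (k + r - 2)).card with hm
  have hn0 : (0 : ℝ) < n := by exact_mod_cast (by omega : 0 < n)
  have hfac : (n.factorial : ℝ) ≤ 2 * n * (cycReps n).card := by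
    exact_mod_cast factorial_le_card_cycReps hn
  have hrow : ∀ σ ∈ cycReps n, ∑ τ ∈ cycReps n,
      p⁻¹ ^ (hamPowEdges r k n σ ∩ hamPowEdges r k n τ).card ≤ D * (cycReps n).card := by
    intro σ hσ
    let e := Equiv.ofBijective σ (hbij σ hσ)
    have h1 := sum_cycReps_le
      (fun τ => p⁻¹ ^ (hamPowEdges r k n σ ∩ hamPowEdges r k n τ).card)
      (fun τ => by positivity) (fun τ hτ t s => pow_le_pow_right₀ hP (card_le_card
        (inter_subset_inter_left (hamPowEdges_subset_dihedralShift hk hr hτ t s))))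
    have h2 : ∑ τ : ZMod n ≃ Fin n, p⁻¹ ^ (hamPowEdges r k n σ ∩ hamPowEdges r k n τ).card ≤
        ∑ θ : Equiv.Perm (ZMod n), p⁻¹ ^ (sharedSets r (k + r - 2) θ).card := by
      rw [← Equiv.sum_comp (Equiv.equivCongr (Equiv.refl (ZMod n)) e.symm)]
      exact Finset.sum_le_sum fun τ _ => pow_le_pow_right₀ hP
        (card_hamPowEdges_inter_le hk hr e τ)
    have h3 : 2 * n * ∑ τ ∈ cycReps n,
        p⁻¹ ^ (hamPowEdges r k n σ ∩ hamPowEdges r k n τ).card ≤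
        2 * n * (D * (cycReps n).card) := by
      refine (h1.trans (h2.trans h)).trans ?_
      calc D * n.factorial ≤ D * (2 * n * (cycReps n).card) := by gcongr
        _ = _ := by ring
    exact le_of_mul_le_mul_left h3 (by positivity)
  have hterm : ∀ σ ∈ cycReps n, ∀ τ ∈ cycReps n,
      p ^ (hamPowEdges r k n σ ∪ hamPowEdges r k n τ).card =
        p ^ (2 * m) * p⁻¹ ^ (hamPowEdges r k n σ ∩ hamPowEdges r k n τ).card := by
    intro σ hσ τ hτ
    have h1 := card_union_add_card_inter (hamPowEdges r k n σ) (hamPowEdges r k n τ)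
    rw [card_hamPowEdges hk hr (hbij σ hσ), card_hamPowEdges hk hr (hbij τ hτ), ← hm,
      ← two_mul] at h1
    rw [← h1, pow_add, mul_assoc, ← mul_pow, mul_inv_cancel₀ hp.ne', one_pow, mul_one]
  rw [expct_XH_sq, expct_XH]
  calc _ = ∑ σ ∈ cycReps n, p ^ (2 * m) * ∑ τ ∈ cycReps n,
          p⁻¹ ^ (hamPowEdges r k n σ ∩ hamPowEdges r k n τ).card := by
        refine Finset.sum_congr rfl fun σ hσ => ?_
        rw [Finset.mul_sum]
        exact Finset.sum_congr rfl fun τ hτ => hterm σ hσ τ hτ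
    _ ≤ ∑ σ ∈ cycReps n, p ^ (2 * m) * (D * (cycReps n).card) := by
        refine Finset.sum_le_sum fun σ hσ => ?_
        gcongr
        exact hrow σ hσ
    _ = D * ((cycReps n).card * p ^ m) ^ 2 := by
        rw [Finset.sum_const, nsmul_eq_mul]
        ring
    _ = _ := by
        rw [Finset.sum_congr rfl fun σ hσ => by rw [card_hamPowEdges hk hr (hbij σ hσ), ← hm],
          Finset.sum_const, nsmul_eq_mul]

end CyclicOrderings

lemma threshold_pow_le {r k : ℕ} (hr : 3 ≤ r) (hk : 1 ≤ k) {C : ℝ}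
    (hC : 4 * Real.exp 1 * (r : ℝ) ^ 2 * ((k + r - 2).choose (r - 1)) *
      ((2 * (k : ℝ) + 2 * r - 3) * Real.exp 1) ^
        ((1 : ℝ) / ((k + r - 2).choose (r - 1))) ≤ C) :
    16 * Real.exp 1 * ((k + r - 2 : ℕ) : ℝ) ^ 3 ≤ C ^ (k + r - 2).choose (r - 1) := by
  set w := k + r - 2 with hw
  set d := w.choose (r - 1) with hd
  have hd1 : 1 ≤ d := Nat.choose_pos (by omega)
  have hkd : k ≤ d := by
    have h := Nat.choose_le_choose (r - 1) (le_refl w)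
    have h1 : k - 1 + 1 ≤ (k - 1 + (r - 1)).choose (k - 1) := by
      calc k - 1 + 1 = (k - 1 + 1).choose (k - 1) := by rw [Nat.choose_succ_self_right]
        _ ≤ _ := Nat.choose_le_choose _ (by omega)
    rw [Nat.choose_symm_add] at h1
    have h2 : k - 1 + (r - 1) = w := by omega
    rw [h2, ← hd] at h1
    omega
  have hwrd : w ≤ r * d := by
    have : r + d ≤ r * d + 1 := by nlinarith
    omega
  have he : 1 ≤ Real.exp 1 := Real.one_le_exp (by norm_num)
  have he2 : 2 ≤ Real.exp 1 := by linarith [Real.add_one_le_exp (1 : ℝ)]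
  have hcast : 2 * (k : ℝ) + 2 * r - 3 = 2 * w + 1 := by
    have : (w : ℝ) + 2 = k + r := by exact_mod_cast (by omega : w + 2 = k + r)
    linarith
  rw [hcast] at hC
  have hd0 : (d : ℝ) ≠ 0 := by exact_mod_cast (by omega : d ≠ 0)
  have hB0 : (0 : ℝ) ≤ (2 * w + 1) * Real.exp 1 := by positivity
  have hroot : (((2 * (w : ℝ) + 1) * Real.exp 1) ^ ((1 : ℝ) / d)) ^ d =
      (2 * w + 1) * Real.exp 1 := by
    rw [one_div, Real.rpow_inv_natCast_pow hB0 (by omega)]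
  have hpow : 8 * (w : ℝ) ^ 2 ≤ (4 * Real.exp 1 * (r : ℝ) ^ 2 * d) ^ d := by
    have hwr : (w : ℝ) ≤ r * d := by exact_mod_cast hwrd
    have hr3 : (3 : ℝ) ≤ r := by exact_mod_cast hr
    have hd1' : (1 : ℝ) ≤ d := by exact_mod_cast hd1
    have hw2 : (w : ℝ) ^ 2 ≤ (r * d) ^ 2 := by gcongr
    have hbase : 8 * (r : ℝ) ^ 2 * d ≤ 4 * Real.exp 1 * (r : ℝ) ^ 2 * d := by
      have : 0 ≤ (r : ℝ) ^ 2 * d := by positivity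
      nlinarith
    have hbig : 1 ≤ 8 * (r : ℝ) ^ 2 * d := by nlinarith [mul_le_mul hr3 hr3 (by norm_num) (by linarith)]
    have hstep : (8 * (r : ℝ) ^ 2 * d) ^ d ≤ (4 * Real.exp 1 * (r : ℝ) ^ 2 * d) ^ d := by gcongr
    refine le_trans ?_ hstep
    rcases hd1.eq_or_lt with h | h
    · rw [← h] at hw2 ⊢
      push_cast at hw2 ⊢
      nlinarith
    · calc 8 * (w : ℝ) ^ 2 ≤ 8 * (r * d) ^ 2 := by gcongr
        _ ≤ (8 * (r : ℝ) ^ 2 * d) ^ 2 := by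
          have h1 : (1 : ℝ) ≤ (r : ℝ) ^ 2 := by nlinarith
          have h2 : 0 ≤ ((r : ℝ) * d) ^ 2 := by positivity
          nlinarith
        _ ≤ _ := pow_le_pow_right₀ hbig h
  calc 16 * Real.exp 1 * (w : ℝ) ^ 3 = 8 * (w : ℝ) ^ 2 * (2 * w * Real.exp 1) := by ring
    _ ≤ (4 * Real.exp 1 * (r : ℝ) ^ 2 * d) ^ d * ((2 * w + 1) * Real.exp 1) := by
      gcongr
      linarith
    _ = (4 * Real.exp 1 * (r : ℝ) ^ 2 * d * ((2 * (w : ℝ) + 1) * Real.exp 1) ^ ((1 : ℝ) / d)) ^ d := by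
      rw [mul_pow _ (((2 * (w : ℝ) + 1) * Real.exp 1) ^ ((1 : ℝ) / d)), hroot]
    _ ≤ C ^ d := pow_le_pow_left₀ (by positivity) hC d

theorem stmt14 (r k : ℕ) (hr : 3 ≤ r) (hk : 1 ≤ k) :
    ∃ D : ℝ, 0 < D ∧ ∀ C : ℝ,
      4 * Real.exp 1 * (r : ℝ) ^ 2 * ((k + r - 2).choose (r - 1)) *
          ((2 * (k : ℝ) + 2 * r - 3) * Real.exp 1) ^
            ((1 : ℝ) / ((k + r - 2).choose (r - 1))) ≤ C →
      ∃ N : ℕ, ∀ n ≥ N,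
        expct n r (C * (n : ℝ) ^ (-(1 : ℝ) / ((k + r - 2).choose (r - 1))))
            (fun H => XH r k n H ^ 2)
          ≤ D * (expct n r (C * (n : ℝ) ^ (-(1 : ℝ) / ((k + r - 2).choose (r - 1))))
              (XH r k n)) ^ 2 := by
  obtain ⟨N, hN⟩ := exists_forall_sum_sharedSets_le hr (show r - 1 ≤ k + r - 2 by omega)
  refine ⟨3 * Real.exp (16 * ((k + r - 2 : ℕ) : ℝ) ^ 2 * Real.exp 1), by positivity,
    fun C hC => ?_⟩
  have hK := threshold_pow_le hr hk hC
  set d := (k + r - 2).choose (r - 1) with hd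
  have hd1 : 1 ≤ d := Nat.choose_pos (by omega)
  have hd0 : (d : ℝ) ≠ 0 := by exact_mod_cast (by omega : d ≠ 0)
  have hC0 : 0 < C := by
    refine lt_of_lt_of_le ?_ hC
    have hr3 : (3 : ℝ) ≤ r := by exact_mod_cast hr
    have hk0 : (0 : ℝ) ≤ k := by positivity
    have h1 : (0 : ℝ) < 2 * (k : ℝ) + 2 * r - 3 := by linarith
    have h2 : (0 : ℝ) < d := by exact_mod_cast hd1
    positivity
  have hK1 : 1 ≤ C ^ d := by
    refine le_trans ?_ hK
    have h1 : (1 : ℝ) ≤ ((k + r - 2 : ℕ) : ℝ) := by exact_mod_cast (by omega : 1 ≤ k + r - 2)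
    have h2 : (1 : ℝ) ≤ Real.exp 1 := Real.one_le_exp (by norm_num)
    have h3 := one_le_pow₀ h1 (n := 3)
    nlinarith
  refine ⟨max N (max 3 ⌈C ^ d⌉₊), fun n hn => ?_⟩
  have hn3 : 3 ≤ n := le_of_max_le_left (le_of_max_le_right hn)
  have hnC : C ^ d ≤ n := (Nat.le_ceil _).trans
    (by exact_mod_cast le_of_max_le_right (le_of_max_le_right hn))
  have : NeZero n := ⟨by omega⟩
  have hn0 : (0 : ℝ) < n := by exact_mod_cast (by omega : 0 < n)
  set p := C * (n : ℝ) ^ (-(1 : ℝ) / d) with hp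
  have hp0 : 0 < p := by positivity
  have hpd : p⁻¹ ^ d = n / C ^ d := by
    rw [inv_pow, hp, mul_pow, ← Real.rpow_mul_natCast hn0.le, div_mul_cancel₀ _ hd0,
      Real.rpow_neg_one]
    field_simp
  have hP1 : 1 ≤ p⁻¹ := by
    rw [← one_le_pow_iff_of_nonneg (by positivity) (by omega : d ≠ 0), hpd,
      one_le_div (by positivity)]
    exact hnC
  exact expct_XH_sq_le (by omega) hk hn3 hp0 ((one_le_inv₀ hp0).mp hP1) (by positivity)
    (hN n (le_of_max_le_left hn) (C ^ d) p⁻¹ hK1 hK hP1 hpd)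

end
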